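/- arXiv:2107.12784 — 2 statements merged into one kernel-verified Lean document; each statement's English description precedes it below -/
import Mathlib

section
/- Let Ω ⊂ ℝ³ be open, let u : ℝ³ → ℝ be three times continuously differentiable on Ω, let p be a continuously differentiable field of symmetric bilinear forms on Ω with pointwise trace P(y) = tr p(y) and squared Frobenius norm ‖p(y)‖_F², and let h : ℝ³ → ℝ be continuously differentiable on Ω. Suppose u satisfies Δu(y) + P(y)‖∇u(y)‖ = h(y)‖∇u(y)‖ for all y ∈ Ω. Fix δ > 0 and set φ_δ(y) = (‖∇u(y)‖² + δ)^{1/2}. Let x ∈ Ω with ∇u(x) ≠ 0 and set ν = ∇u(x)/‖∇u(x)‖, μ(x) = (1/2)(P(x)² − ‖p(x)‖_F²), H = (Δu(x) − ∇²u(x)(ν,ν))/‖∇u(x)‖, ‖A‖² = (‖∇²u(x)‖_F² − 2‖∇²u(x)(ν)‖² + ∇²u(x)(ν,ν)²)/‖∇u(x)‖², K = (H² − ‖A‖²)/2, and let ∇̄²u(x) = ∇²u(x) + ‖∇u(x)‖ p(x) denote the spacetime Hessian. Then Δφ_δ(x) ≥ (1/(2 φ_δ(x))) [ ‖∇̄²u(x)‖_F²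 − 2 ⟨p(x), ∇²u(x)⟩_F ‖∇u(x)‖ + (2 μ(x) − 2K) ‖∇u(x)‖² − 2 ‖∇u(x)‖ ⟨∇u(x), ∇P(x)⟩ + ‖∇u(x)‖² ( h(x)² − 2 h(x) P(x) + 2 ⟨ν, ∇h(x)⟩ ) ]. -/
open scoped RealInnerProductSpace

noncomputable section

/-- Standard orthonormal basis vector of Euclidean space. -/
def stdE (n : ℕ) (i : Fin n) : EuclideanSpace ℝ (Fin n) := EuclideanSpace.single i 1

/-- The Laplacian `Δu(x) = ∑ i, ∂ᵢ∂ᵢ u (x)`. -/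
def lap {n : ℕ} (u : EuclideanSpace ℝ (Fin n) → ℝ) (x : EuclideanSpace ℝ (Fin n)) : ℝ :=
  ∑ i, fderiv ℝ (fun y => fderiv ℝ u y (stdE n i)) x (stdE n i)

/-- The Hessian bilinear form `∇²u(x)(v,w)`. -/
def hessB {n : ℕ} (u : EuclideanSpace ℝ (Fin n) → ℝ) (x v w : EuclideanSpace ℝ (Fin n)) : ℝ :=
  fderiv ℝ (fun y => fderiv ℝ u y w) x v

/-- The Hessian operator `∇²u(x)` applied to a vector `v`, i.e. the vector with
components `∑ⱼ ∂ᵢ∂ⱼ u(x) vⱼ`. -/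
def hessV {n : ℕ} (u : EuclideanSpace ℝ (Fin n) → ℝ) (x v : EuclideanSpace ℝ (Fin n)) :
    EuclideanSpace ℝ (Fin n) :=
  gradient (fun y => fderiv ℝ u y v) x

/-- The squared Frobenius norm of the Hessian, `∑ᵢⱼ (∂ᵢ∂ⱼ u(x))²`. -/
def hessFrob2 {n : ℕ} (u : EuclideanSpace ℝ (Fin n) → ℝ) (x : EuclideanSpace ℝ (Fin n)) : ℝ :=
  ∑ i, ∑ j, (hessB u x (stdE n i) (stdE n j)) ^ 2

/-- The divergence `div F(x) = ∑ i, ∂ᵢ Fᵢ (x)` of a vector field. -/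
def divg {n : ℕ} (F : EuclideanSpace ℝ (Fin n) → EuclideanSpace ℝ (Fin n))
    (x : EuclideanSpace ℝ (Fin n)) : ℝ :=
  ∑ i, fderiv ℝ (fun y => ⟪F y, stdE n i⟫) x (stdE n i)

theorem gradient_apply_stdE {n : ℕ} (f : EuclideanSpace ℝ (Fin n) → ℝ)
    (y : EuclideanSpace ℝ (Fin n)) (i : Fin n) :
    gradient f y i = fderiv ℝ f y (stdE n i) := by
  have h1 : ⟪gradient f y, stdE n i⟫ = fderiv ℝ f y (stdE n i) := by
    simp [gradient]
  rw [← h1, stdE, EuclideanSpace.inner_single_right]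
  simp

theorem norm_gradient_sq {n : ℕ} (f : EuclideanSpace ℝ (Fin n) → ℝ)
    (y : EuclideanSpace ℝ (Fin n)) :
    ‖gradient f y‖ ^ 2 = ∑ i, fderiv ℝ f y (stdE n i) ^ 2 := by
  simp [EuclideanSpace.norm_sq_eq, gradient_apply_stdE]

theorem clm_apply_eq_sum_stdE {n : ℕ} (L : EuclideanSpace ℝ (Fin n) →L[ℝ] ℝ)
    (v : EuclideanSpace ℝ (Fin n)) : L v = ∑ i, v i * L (stdE n i) := by
  conv_lhs => rw [← (EuclideanSpace.basisFun (Fin n) ℝ).sum_repr v]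
  simp [stdE]

theorem inner_gradient_eq_sum {n : ℕ} (f : EuclideanSpace ℝ (Fin n) → ℝ)
    (v y : EuclideanSpace ℝ (Fin n)) :
    ⟪v, gradient f y⟫ = ∑ i, v i * fderiv ℝ f y (stdE n i) := by
  simpa using clm_apply_eq_sum_stdE (fderiv ℝ f y) v

/-- Directional derivatives of a `C^(m+1)` function are `C^m`. -/
theorem ContDiffAt.fderiv_apply_const {n : ℕ} {m k : WithTop ℕ∞}
    {f : EuclideanSpace ℝ (Fin n) → ℝ} {x : EuclideanSpace ℝ (Fin n)}
    (hf : ContDiffAt ℝ k f x) (hmk : m + 1 ≤ k) (v : EuclideanSpace ℝ (Fin n)) :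
    ContDiffAt ℝ m (fun y => fderiv ℝ f y v) x :=
  (hf.fderiv_right hmk).clm_apply contDiffAt_const

/-- Second directional derivatives of a `C²` function commute. -/
theorem hessB_comm {n : ℕ} {f : EuclideanSpace ℝ (Fin n) → ℝ} {x : EuclideanSpace ℝ (Fin n)}
    (hf : ContDiffAt ℝ 2 f x) (v w : EuclideanSpace ℝ (Fin n)) :
    hessB f x v w = hessB f x w v := by
  have hd : DifferentiableAt ℝ (fderiv ℝ f) x :=
    (hf.fderiv_right (m := 1) (by norm_num)).differentiableAt (by norm_num)
  have key : ∀ a b, hessB f x a b = fderiv ℝ (fderiv ℝ f) x a b := fun a b => by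
    simp [hessB, fderiv_clm_apply hd (differentiableAt_const b)]
  rw [key, key]
  exact (hf.isSymmSndFDerivAt (by simp)).eq v w

theorem hessB_eq_sum_right {n : ℕ} {f : EuclideanSpace ℝ (Fin n) → ℝ}
    {x : EuclideanSpace ℝ (Fin n)} (hf : ContDiffAt ℝ 2 f x) (v w : EuclideanSpace ℝ (Fin n)) :
    hessB f x v w = ∑ j, w j * hessB f x v (stdE n j) := by
  rw [hessB_comm hf]
  simp only [hessB_comm hf v]
  exact clm_apply_eq_sum_stdE _ _

theorem norm_hessV_sq {n : ℕ} (f : EuclideanSpace ℝ (Fin n) → ℝ)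
    (x v : EuclideanSpace ℝ (Fin n)) :
    ‖hessV f x v‖ ^ 2 = ∑ i, hessB f x (stdE n i) v ^ 2 :=
  norm_gradient_sq _ _

theorem hasFDerivAt_norm_gradient_sq {n : ℕ} {f : EuclideanSpace ℝ (Fin n) → ℝ}
    {x : EuclideanSpace ℝ (Fin n)} (hf : ContDiffAt ℝ 2 f x) :
    HasFDerivAt (fun y => ‖gradient f y‖ ^ 2)
      (∑ k, (2 * fderiv ℝ f x (stdE n k)) •
        fderiv ℝ (fun y => fderiv ℝ f y (stdE n k)) x) x := by
  simp only [norm_gradient_sq]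
  refine HasFDerivAt.fun_sum fun k _ => ?_
  have hk : DifferentiableAt ℝ (fun y => fderiv ℝ f y (stdE n k)) x :=
    (hf.fderiv_apply_const (m := 1) (by norm_num) _).differentiableAt (by norm_num)
  simpa using hk.hasFDerivAt.pow 2

/-- The derivative of `(‖∇f‖² + δ)^{1/2}`. -/
theorem fderiv_sqrt_norm_gradient_sq {n : ℕ} {f : EuclideanSpace ℝ (Fin n) → ℝ}
    {x : EuclideanSpace ℝ (Fin n)} (hf : ContDiffAt ℝ 2 f x) {δ : ℝ}
    (hδ : ‖gradient f x‖ ^ 2 + δ ≠ 0) (v : EuclideanSpace ℝ (Fin n)) :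
    DifferentiableAt ℝ (fun y => √(‖gradient f y‖ ^ 2 + δ)) x ∧
    fderiv ℝ (fun y => √(‖gradient f y‖ ^ 2 + δ)) x v =
      (∑ k, fderiv ℝ f x (stdE n k) * hessB f x v (stdE n k)) /
        √(‖gradient f x‖ ^ 2 + δ) := by
  have hd := ((hasFDerivAt_norm_gradient_sq hf).add_const δ).sqrt hδ
  refine ⟨hd.differentiableAt, ?_⟩
  rw [hd.fderiv]
  simp only [smul_apply, sum_apply, smul_eq_mul, hessB,
    mul_assoc, ← Finset.mul_sum]
  field_simp

theorem lap_fderiv_apply {n : ℕ} {f : EuclideanSpace ℝ (Fin n) → ℝ}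
    {x : EuclideanSpace ℝ (Fin n)} (hf : ContDiffAt ℝ 3 f x) (v : EuclideanSpace ℝ (Fin n)) :
    lap (fun y => fderiv ℝ f y v) x = fderiv ℝ (lap f) x v := by
  have h2 : ∀ w, ContDiffAt ℝ 2 (fun y => fderiv ℝ f y w) x := fun w =>
    hf.fderiv_apply_const (by norm_num) w
  have hev : ∀ᶠ y in nhds x, ContDiffAt ℝ 3 f y := hf.eventually (by simp)
  have hR : fderiv ℝ (lap f) x v =
      ∑ i, hessB (fun y => fderiv ℝ f y (stdE n i)) x v (stdE n i) := by
    have : HasFDerivAt (lap f) (∑ i, fderiv ℝ (fun y => fderiv ℝ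
        (fun z => fderiv ℝ f z (stdE n i)) y (stdE n i)) x) x := by
      refine HasFDerivAt.fun_sum fun i _ => DifferentiableAt.hasFDerivAt ?_
      exact ((h2 _).fderiv_apply_const (m := 1) (by norm_num) _).differentiableAt (by norm_num)
    rw [this.fderiv]
    simp [hessB]
  rw [hR]
  refine Finset.sum_congr rfl fun i _ => ?_
  rw [hessB_comm (h2 _)]
  refine congrArg (fun L : EuclideanSpace ℝ (Fin n) →L[ℝ] ℝ => L (stdE n i))
    (Filter.EventuallyEq.fderiv_eq ?_)
  filter_upwards [hev] with y hy
  exact hessB_comm (hy.of_le (by norm_num)) (stdE n i) v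

/-- The Bochner formula for `(‖∇f‖² + δ)^{1/2}`. -/
theorem lap_sqrt_norm_gradient_sq {n : ℕ} {f : EuclideanSpace ℝ (Fin n) → ℝ}
    {x : EuclideanSpace ℝ (Fin n)} (hf : ContDiffAt ℝ 3 f x) {δ : ℝ} (hδ : 0 < δ) :
    lap (fun y => √(‖gradient f y‖ ^ 2 + δ)) x =
      (hessFrob2 f x + ⟪gradient f x, gradient (lap f) x⟫) / √(‖gradient f x‖ ^ 2 + δ) -
        (∑ i, (∑ k, fderiv ℝ f x (stdE n k) * hessB f x (stdE n i) (stdE n k)) ^ 2) /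
          √(‖gradient f x‖ ^ 2 + δ) ^ 3 := by
  have hev : ∀ᶠ y in nhds x, ContDiffAt ℝ 3 f y := hf.eventually (by simp)
  have hpos : ∀ y, 0 < ‖gradient f y‖ ^ 2 + δ := fun y => by positivity
  have h2 : ∀ w, ContDiffAt ℝ 2 (fun y => fderiv ℝ f y w) x := fun w =>
    hf.fderiv_apply_const (by norm_num) w
  have hterm : ∀ i, fderiv ℝ (fun y => fderiv ℝ (fun y => √(‖gradient f y‖ ^ 2 + δ)) y
      (stdE n i)) x (stdE n i) =
      (∑ k, (hessB f x (stdE n i) (stdE n k) ^ 2 + fderiv ℝ f x (stdE n k) *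
        hessB (fun y => fderiv ℝ f y (stdE n k)) x (stdE n i) (stdE n i))) /
          √(‖gradient f x‖ ^ 2 + δ) -
      (∑ k, fderiv ℝ f x (stdE n k) * hessB f x (stdE n i) (stdE n k)) ^ 2 /
          √(‖gradient f x‖ ^ 2 + δ) ^ 3 := by
    intro i
    have heq : (fun y => fderiv ℝ (fun y => √(‖gradient f y‖ ^ 2 + δ)) y (stdE n i)) =ᶠ[nhds x]
        fun y => (∑ k, fderiv ℝ f y (stdE n k) * hessB f y (stdE n i) (stdE n k)) /
          √(‖gradient f y‖ ^ 2 + δ) := by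
      filter_upwards [hev] with y hy
      exact (fderiv_sqrt_norm_gradient_sq (hy.of_le (by norm_num)) (hpos y).ne' _).2
    rw [heq.fderiv_eq]
    obtain ⟨hφd, hφ⟩ := fderiv_sqrt_norm_gradient_sq (hf.of_le (by norm_num)) (hpos x).ne'
      (stdE n i)
    have hN : HasFDerivAt
        (fun y => ∑ k, fderiv ℝ f y (stdE n k) * hessB f y (stdE n i) (stdE n k))
        (∑ k, (fderiv ℝ f x (stdE n k) •
            fderiv ℝ (fun y => hessB f y (stdE n i) (stdE n k)) x +
          hessB f x (stdE n i) (stdE n k) •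
            fderiv ℝ (fun y => fderiv ℝ f y (stdE n k)) x)) x := by
      refine HasFDerivAt.fun_sum fun k _ => HasFDerivAt.mul ?_ ?_
      · exact ((h2 _).differentiableAt (by norm_num)).hasFDerivAt
      · exact (((h2 _).fderiv_apply_const (m := 1) (by norm_num) _).differentiableAt
          (by norm_num)).hasFDerivAt
    have hs : √(‖gradient f x‖ ^ 2 + δ) ≠ 0 := (Real.sqrt_pos.2 (hpos x)).ne'
    have hinv : HasFDerivAt (fun y => (√(‖gradient f y‖ ^ 2 + δ))⁻¹)
        (-(√(‖gradient f x‖ ^ 2 + δ) ^ 2)⁻¹ •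
          fderiv ℝ (fun y => √(‖gradient f y‖ ^ 2 + δ)) x) x :=
      (hasDerivAt_inv hs).comp_hasFDerivAt x hφd.hasFDerivAt
    simp only [div_eq_mul_inv]
    rw [(hN.fun_mul hinv).fderiv]
    simp only [smul_apply, smul_eq_mul, hφ,
      sum_apply, add_apply]
    have hsum : (∑ k, (fderiv ℝ f x (stdE n k) *
            fderiv ℝ (fun y => hessB f y (stdE n i) (stdE n k)) x (stdE n i) +
          hessB f x (stdE n i) (stdE n k) *
            fderiv ℝ (fun y => fderiv ℝ f y (stdE n k)) x (stdE n i))) =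
        ∑ k, (hessB f x (stdE n i) (stdE n k) ^ 2 + fderiv ℝ f x (stdE n k) *
          hessB (fun y => fderiv ℝ f y (stdE n k)) x (stdE n i) (stdE n i)) := by
      refine Finset.sum_congr rfl fun k _ => ?_
      simp only [hessB]
      ring
    rw [hsum]
    field_simp
    ring
  have hcross : ⟪gradient f x, gradient (lap f) x⟫ =
      ∑ i, ∑ k, fderiv ℝ f x (stdE n k) *
        hessB (fun y => fderiv ℝ f y (stdE n k)) x (stdE n i) (stdE n i) := by
    rw [inner_gradient_eq_sum, Finset.sum_comm]
    refine Finset.sum_congr rfl fun k _ => ?_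
    rw [← lap_fderiv_apply hf, gradient_apply_stdE, ← Finset.mul_sum]
    rfl
  rw [lap, Finset.sum_congr rfl fun i _ => hterm i, Finset.sum_sub_distrib, ← Finset.sum_div,
    ← Finset.sum_div, hcross, hessFrob2, ← Finset.sum_add_distrib]
  simp only [Finset.sum_add_distrib]

theorem hessB_smul_left {n : ℕ} (f : EuclideanSpace ℝ (Fin n) → ℝ)
    (x v w : EuclideanSpace ℝ (Fin n)) (c : ℝ) : hessB f x (c • v) w = c * hessB f x v w := by
  simp [hessB]

theorem hessB_smul_right {n : ℕ} {f : EuclideanSpace ℝ (Fin n) → ℝ}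
    {x : EuclideanSpace ℝ (Fin n)} (hf : ContDiffAt ℝ 2 f x) (v w : EuclideanSpace ℝ (Fin n))
    (c : ℝ) : hessB f x v (c • w) = c * hessB f x v w := by
  rw [hessB_comm hf, hessB_smul_left, hessB_comm hf]

theorem sum_fderiv_mul_hessB {n : ℕ} {f : EuclideanSpace ℝ (Fin n) → ℝ}
    {x : EuclideanSpace ℝ (Fin n)} (hf : ContDiffAt ℝ 2 f x) (v : EuclideanSpace ℝ (Fin n)) :
    ∑ k, fderiv ℝ f x (stdE n k) * hessB f x v (stdE n k) = hessB f x v (gradient f x) := by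
  simp only [hessB_eq_sum_right hf v (gradient f x), gradient_apply_stdE]

/-- The derivative of `‖∇f‖` away from critical points. -/
theorem fderiv_norm_gradient {n : ℕ} {f : EuclideanSpace ℝ (Fin n) → ℝ}
    {x : EuclideanSpace ℝ (Fin n)} (hf : ContDiffAt ℝ 2 f x) (h0 : gradient f x ≠ 0)
    (v : EuclideanSpace ℝ (Fin n)) :
    DifferentiableAt ℝ (fun y => ‖gradient f y‖) x ∧
    fderiv ℝ (fun y => ‖gradient f y‖) x v = hessB f x v (gradient f x) / ‖gradient f x‖ := by
  have := fderiv_sqrt_norm_gradient_sq hf (δ := 0) (by simpa using h0) v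
  simpa only [add_zero, Real.sqrt_sq (norm_nonneg _), sum_fderiv_mul_hessB hf] using this

/-- If `Δf = q ‖∇f‖` near a noncritical point, this computes `⟪∇f, ∇Δf⟫` there. -/
theorem inner_gradient_lap_of_eventuallyEq {n : ℕ} {f q : EuclideanSpace ℝ (Fin n) → ℝ}
    {x : EuclideanSpace ℝ (Fin n)} (hf : ContDiffAt ℝ 2 f x) (hq : DifferentiableAt ℝ q x)
    (h0 : gradient f x ≠ 0) (heq : lap f =ᶠ[nhds x] fun y => q y * ‖gradient f y‖) :
    ⟪gradient f x, gradient (lap f) x⟫ =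
      q x * (hessB f x (gradient f x) (gradient f x) / ‖gradient f x‖) +
        ‖gradient f x‖ * fderiv ℝ q x (gradient f x) := by
  obtain ⟨hd, hv⟩ := fderiv_norm_gradient hf h0 (gradient f x)
  rw [inner_gradient_right, heq.fderiv_eq, fderiv_fun_mul hq hd]
  simp [hv]

/-- key pointwise integrand estimate in Euclidean space. Let `u` be `C³`
on an open `Ω ⊆ ℝ³`, let `p` be a `C¹` field of symmetric bilinear forms (given by its
components `p y i j`) with trace `P` and let `h` be `C¹`, with `u` solving the perturbed
spacetime Laplacian equation `Δu + P|∇u| = h|∇u|` on `Ω`. At a noncritical point `x`,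
with `ν` the unit normal, `μ` the (flat) energy density, `H`, `‖A‖²`, `K` the level set
mean curvature, squared second fundamental form and Gauss curvature expressed via the
Hessian, and `∇̄²u = ∇²u + |∇u| p` the spacetime Hessian, the regularized gradient
`φ_δ = (‖∇u‖² + δ)^{1/2}` satisfies
`Δφ_δ(x) ≥ (1/(2φ_δ)) [‖∇̄²u‖_F² − 2⟨p,∇²u⟩_F |∇u| + (2μ − 2K)|∇u|²
  − 2|∇u|⟨∇u, ∇P⟩ + |∇u|²(h² − 2hP + 2⟨ν, ∇h⟩)]`. -/
theorem integrand_estimate {Ω : Set (EuclideanSpace ℝ (Fin 3))} (hΩ : IsOpen Ω)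
    {u : EuclideanSpace ℝ (Fin 3) → ℝ} (hu : ContDiffOn ℝ 3 u Ω)
    (p : EuclideanSpace ℝ (Fin 3) → Fin 3 → Fin 3 → ℝ)
    (hpsymm : ∀ y ∈ Ω, ∀ i j, p y i j = p y j i)
    (hpC1 : ∀ i j, ContDiffOn ℝ 1 (fun y => p y i j) Ω)
    {h : EuclideanSpace ℝ (Fin 3) → ℝ} (hh : ContDiffOn ℝ 1 h Ω)
    (P : EuclideanSpace ℝ (Fin 3) → ℝ) (hP : ∀ y, P y = ∑ i, p y i i)
    (heq : ∀ y ∈ Ω, lap u y + P y * ‖gradient u y‖ = h y * ‖gradient u y‖)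
    {δ : ℝ} (hδ : 0 < δ)
    (φ : EuclideanSpace ℝ (Fin 3) → ℝ)
    (hφ : ∀ y, φ y = Real.sqrt (‖gradient u y‖ ^ 2 + δ))
    {x : EuclideanSpace ℝ (Fin 3)} (hx : x ∈ Ω) (h0 : gradient u x ≠ 0)
    (ν : EuclideanSpace ℝ (Fin 3)) (hν : ν = ‖gradient u x‖⁻¹ • gradient u x)
    (μ : ℝ) (hμ : μ = (1 / 2 : ℝ) * ((P x) ^ 2 - ∑ i, ∑ j, (p x i j) ^ 2))
    (H : ℝ) (hH : H = (lap u x - hessB u x ν ν) / ‖gradient u x‖)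
    (A2 : ℝ)
    (hA2 : A2 =
      (hessFrob2 u x - 2 * ‖hessV u x ν‖ ^ 2 + (hessB u x ν ν) ^ 2) / ‖gradient u x‖ ^ 2)
    (K : ℝ) (hK : K = (H ^ 2 - A2) / 2) :
    lap φ x ≥
      (1 / (2 * φ x)) *
        ((∑ i, ∑ j,
            (hessB u x (stdE 3 i) (stdE 3 j) + ‖gradient u x‖ * p x i j) ^ 2)
          - 2 * (∑ i, ∑ j, p x i j * hessB u x (stdE 3 i) (stdE 3 j)) * ‖gradient u x‖
          + (2 * μ - 2 * K) * ‖gradient u x‖ ^ 2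
          - 2 * ‖gradient u x‖ * ⟪gradient u x, gradient P x⟫
          + ‖gradient u x‖ ^ 2 *
              ((h x) ^ 2 - 2 * h x * P x + 2 * ⟪ν, gradient h x⟫)) := by
  have hΩx : Ω ∈ nhds x := hΩ.mem_nhds hx
  have hux : ContDiffAt ℝ 3 u x := hu.contDiffAt hΩx
  have hux2 : ContDiffAt ℝ 2 u x := hux.of_le (by norm_num)
  have hhd : DifferentiableAt ℝ h x := (hh.contDiffAt hΩx).differentiableAt (by norm_num)
  have hPd : DifferentiableAt ℝ P x := by
    rw [funext hP]
    exact DifferentiableAt.fun_sum fun i _ =>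
      ((hpC1 i i).contDiffAt hΩx).differentiableAt (by norm_num)
  have hlap : lap u =ᶠ[nhds x] fun y => (h y - P y) * ‖gradient u y‖ := by
    filter_upwards [hΩx] with y hy
    linarith [heq y hy]
  have hLx : lap u x = (h x - P x) * ‖gradient u x‖ := hlap.eq_of_nhds
  have hG : 0 < ‖gradient u x‖ := norm_pos_iff.2 h0
  have hgrad : gradient u x = ‖gradient u x‖ • ν := by
    rw [hν, smul_inv_smul₀ hG.ne']
  have hcross : ⟪gradient u x, gradient (lap u) x⟫ =
      (h x - P x) * ‖gradient u x‖ * hessB u x ν ν +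
        ‖gradient u x‖ ^ 2 * (fderiv ℝ h x ν - fderiv ℝ P x ν) := by
    have hB : hessB u x (gradient u x) (gradient u x) = ‖gradient u x‖ ^ 2 * hessB u x ν ν := by
      conv_lhs => rw [hgrad, hessB_smul_left, hessB_smul_right hux2]
      ring
    have hD : fderiv ℝ (fun y => h y - P y) x (gradient u x) =
        ‖gradient u x‖ * (fderiv ℝ h x ν - fderiv ℝ P x ν) := by
      rw [fderiv_fun_sub hhd hPd]
      conv_lhs => rw [hgrad]
      simp
    rw [inner_gradient_lap_of_eventuallyEq hux2 (hhd.sub hPd) h0 hlap, hB]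
    simp only [Pi.sub_def, hD]
    field_simp
  have hHess : ∑ i, (∑ k, fderiv ℝ u x (stdE 3 k) * hessB u x (stdE 3 i) (stdE 3 k)) ^ 2 =
      ‖gradient u x‖ ^ 2 * ‖hessV u x ν‖ ^ 2 := by
    simp only [sum_fderiv_mul_hessB hux2]
    conv_lhs => rw [hgrad]
    simp only [hessB_smul_right hux2, mul_pow, ← Finset.mul_sum, norm_hessV_sq]
  have hexp : ∑ i, ∑ j, (hessB u x (stdE 3 i) (stdE 3 j) + ‖gradient u x‖ * p x i j) ^ 2 =
      hessFrob2 u x +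
        2 * ‖gradient u x‖ * (∑ i, ∑ j, p x i j * hessB u x (stdE 3 i) (stdE 3 j)) +
        ‖gradient u x‖ ^ 2 * ∑ i, ∑ j, p x i j ^ 2 := by
    simp only [hessFrob2, Finset.mul_sum, ← Finset.sum_add_distrib]
    exact Finset.sum_congr rfl fun i _ => Finset.sum_congr rfl fun j _ => by ring
  have hinnerP : ⟪gradient u x, gradient P x⟫ = ‖gradient u x‖ * fderiv ℝ P x ν := by
    rw [inner_gradient_right]
    conv_lhs => rw [hgrad]
    simp
  have hφx : φ x ^ 2 = ‖gradient u x‖ ^ 2 + δ := by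
    rw [hφ, Real.sq_sqrt (by positivity)]
  have hφpos : 0 < φ x := by
    rw [hφ]
    positivity
  have hlapφ : lap φ x = (hessFrob2 u x + ((h x - P x) * ‖gradient u x‖ * hessB u x ν ν +
        ‖gradient u x‖ ^ 2 * (fderiv ℝ h x ν - fderiv ℝ P x ν))) / φ x -
      ‖gradient u x‖ ^ 2 * ‖hessV u x ν‖ ^ 2 / φ x ^ 3 := by
    rw [funext hφ, lap_sqrt_norm_gradient_sq hux hδ, hcross, hHess]
  have hKG : 2 * K * ‖gradient u x‖ ^ 2 = (lap u x - hessB u x ν ν) ^ 2 -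
      (hessFrob2 u x - 2 * ‖hessV u x ν‖ ^ 2 + (hessB u x ν ν) ^ 2) := by
    rw [hK, hH, hA2]
    field_simp
  have hdrop : ‖gradient u x‖ ^ 2 * ‖hessV u x ν‖ ^ 2 / φ x ^ 3 ≤ ‖hessV u x ν‖ ^ 2 / φ x := by
    rw [div_le_div_iff₀ (by positivity) hφpos]
    have : ‖gradient u x‖ ^ 2 ≤ φ x ^ 2 := by linarith
    calc ‖gradient u x‖ ^ 2 * ‖hessV u x ν‖ ^ 2 * φ x
        ≤ φ x ^ 2 * ‖hessV u x ν‖ ^ 2 * φ x := by gcongr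
      _ = ‖hessV u x ν‖ ^ 2 * φ x ^ 3 := by ring
  rw [hlapφ, hexp, hinnerP, inner_gradient_right, conj_trivial]
  refine le_trans (le_of_eq ?_) (sub_le_sub_left hdrop _)
  rw [sub_mul, hKG, hμ, hLx]
  field_simp
  ring
end
end

section
/- Let Ω ⊂ ℝ³ be open, let f, u : ℝ³ → ℝ be twice continuously differentiable on Ω, let x ∈ Ω, set c = f(x) and S = { y ∈ Ω : f(y) = c }. Suppose ∇f(y) ≠ 0 for all y ∈ S, and let η(y) = ∇f(y)/‖∇f(y)‖. Suppose ⟨∇u(y), η(y)⟩ = 0 for all y ∈ S, and suppose ∇u(x) ≠ 0; set ν = ∇u(x)/‖∇u(x)‖ and let e₁ ∈ ℝ³ be a unit vector orthogonal to both η(x) and ν. Let p be a symmetric bilinear form on ℝ³. Then ⟨η(x), ∇(‖∇u‖)(x)⟩ + p(∇u(x), η(x)) = ( − div η(x) + p(ν, η(x)) + ⟨(Dη(x))(e₁), e₁⟩ ) ‖∇u(x)‖. -/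
open scoped RealInnerProductSpace

noncomputable section

section Helpers

open InnerProductSpace Filter Topology

variable {E : Type*} [NormedAddCommGroup E] [InnerProductSpace ℝ E]

theorem inner_gradient_eq_fderiv [CompleteSpace E] (f : E → ℝ) (x v : E) :
    ⟪gradient f x, v⟫ = fderiv ℝ f x v := by
  rw [← toDual_gradient, toDual_apply_apply]

theorem gradient_eq_toDual_symm_comp_fderiv [CompleteSpace E] (f : E → ℝ) :
    gradient f = (toDual ℝ E).symm ∘ fderiv ℝ f := rfl

theorem ContDiffAt.contDiffAt_gradient [CompleteSpace E] {f : E → ℝ} {x : E}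
    (hf : ContDiffAt ℝ 2 f x) : ContDiffAt ℝ 1 (gradient f) x := by
  rw [gradient_eq_toDual_symm_comp_fderiv]
  exact (toDual ℝ E).symm.toContinuousLinearEquiv.contDiff.contDiffAt.comp x
    (hf.fderiv_right (by norm_num [one_add_one_eq_two]))

theorem ContDiffAt.inner_fderiv_gradient_comm [CompleteSpace E] {f : E → ℝ} {x : E}
    (hf : ContDiffAt ℝ 2 f x) (v w : E) :
    ⟪fderiv ℝ (gradient f) x v, w⟫ = ⟪fderiv ℝ (gradient f) x w, v⟫ := by
  have hd : DifferentiableAt ℝ (fderiv ℝ f) x :=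
    (hf.fderiv_right (m := 1) (by norm_num [one_add_one_eq_two])).differentiableAt (by simp)
  have key (a b : E) : ⟪fderiv ℝ (gradient f) x a, b⟫ = fderiv ℝ (fderiv ℝ f) x a b := by
    have hG := hf.contDiffAt_gradient.differentiableAt (by simp)
    have h := fderiv_inner_apply ℝ hG (differentiableAt_const b) a
    simp only [inner_gradient_eq_fderiv] at h
    simpa [fderiv_clm_apply hd (differentiableAt_const b)] using h.symm
  rw [key, key]
  exact hf.isSymmSndFDerivAt (by simp) v w

theorem DifferentiableAt.norm_mul_fderiv_norm {F : Type*} [NormedAddCommGroup F]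
    [NormedSpace ℝ F] {G : F → E} {x : F} (hG : DifferentiableAt ℝ G x) (h0 : G x ≠ 0) (v : F) :
    ‖G x‖ * fderiv ℝ (fun y => ‖G y‖) x v = ⟪G x, fderiv ℝ G x v⟫ := by
  have h1 := (hG.norm ℝ h0).hasFDerivAt.pow 2
  have h2 := congrArg (fun L : F →L[ℝ] ℝ => L v) (h1.unique hG.hasFDerivAt.norm_sq)
  simp at h2
  linarith

theorem inner_fderiv_self_eq_zero_of_norm_eq_one {F : Type*} [NormedAddCommGroup F]
    [NormedSpace ℝ F] {η : F → E} {x : F} (hη : DifferentiableAt ℝ η x)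
    (h1 : ∀ᶠ y in 𝓝 x, ‖η y‖ = 1) (v : F) : ⟪η x, fderiv ℝ η x v⟫ = 0 := by
  have h0 : η x ≠ 0 := norm_ne_zero_iff.1 (by simp [h1.self_of_nhds])
  have hc : (fun y => ‖η y‖) =ᶠ[𝓝 x] fun _ => (1 : ℝ) := h1
  rw [← hη.norm_mul_fderiv_norm h0 v, hc.fderiv_eq]
  simp

theorem fderiv_eq_zero_of_eq_const_on_levelSet {F : Type*} [NormedAddCommGroup F]
    [NormedSpace ℝ F] [CompleteSpace F] {f φ : F → ℝ} {x : F} {c : ℝ}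
    (hf : ContDiffAt ℝ 1 f x) (hφ : ContDiffAt ℝ 1 φ x) (hf0 : fderiv ℝ f x ≠ 0)
    (hφc : ∀ᶠ y in 𝓝 x, f y = f x → φ y = c) {v : F} (hv : fderiv ℝ f x v = 0) :
    fderiv ℝ φ x v = 0 := by
  have hextr : IsLocalExtrOn φ {y | f y = f x} x := by
    refine Or.inl ?_
    filter_upwards [nhdsWithin_le_nhds hφc, self_mem_nhdsWithin] with y hy hyf
    rw [hy hyf, hφc.self_of_nhds rfl]
  obtain ⟨a, b, hab, h⟩ := hextr.exists_multipliers_of_hasStrictFDerivAt_1d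
    (hf.hasStrictFDerivAt (by simp)) (hφ.hasStrictFDerivAt (by simp))
  have hb : b ≠ 0 := by
    rintro rfl
    have ha : a ≠ 0 := fun ha => hab (by simp [ha])
    simp [ha, hf0] at h
  have hv' := congrArg (fun L : F →L[ℝ] ℝ => L v) h
  simpa [hv, hb] using hv'

theorem divg_eq_sum_inner {n : ℕ} {ι : Type*} [Fintype ι]
    {F : EuclideanSpace ℝ (Fin n) → EuclideanSpace ℝ (Fin n)} {x : EuclideanSpace ℝ (Fin n)}
    (hF : DifferentiableAt ℝ F x) (b : OrthonormalBasis ι ℝ (EuclideanSpace ℝ (Fin n))) :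
    divg F x = ∑ i, ⟪b i, fderiv ℝ F x (b i)⟫ := by
  have h := (LinearMap.trace_eq_sum_inner (fderiv ℝ F x).toLinearMap
    (EuclideanSpace.basisFun (Fin n) ℝ)).symm.trans (LinearMap.trace_eq_sum_inner _ b)
  refine Eq.trans (Finset.sum_congr rfl fun i _ => ?_) h
  rw [fderiv_inner_apply ℝ hF (differentiableAt_const _)]
  simp [stdE, real_inner_comm]

theorem divg_eq_of_orthonormal
    {F : EuclideanSpace ℝ (Fin 3) → EuclideanSpace ℝ (Fin 3)} {x : EuclideanSpace ℝ (Fin 3)}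
    (hF : DifferentiableAt ℝ F x) {a b c : EuclideanSpace ℝ (Fin 3)}
    (h : Orthonormal ℝ ![a, b, c]) :
    divg F x = ⟪a, fderiv ℝ F x a⟫ + ⟪b, fderiv ℝ F x b⟫ + ⟪c, fderiv ℝ F x c⟫ := by
  have hcard : Fintype.card (Fin 3) = Module.finrank ℝ (EuclideanSpace ℝ (Fin 3)) := by simp
  have hspan := (basisOfOrthonormalOfCardEqFinrank h hcard).span_eq
  rw [coe_basisOfOrthonormalOfCardEqFinrank] at hspan
  rw [divg_eq_sum_inner hF (OrthonormalBasis.mk h hspan.ge)]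
  simp [Fin.sum_univ_three]

end Helpers

/-- Euclidean pointwise Neumann boundary lemma, full form. Let `f, u`
be `C²` on an open `Ω ⊆ ℝ³`, `S = {y ∈ Ω | f y = f x}` a regular level set with unit
normal `η = ∇f/‖∇f‖`, suppose the Neumann condition `⟨∇u, η⟩ = 0` holds on `S`, let
`∇u(x) ≠ 0`, `ν = ∇u(x)/‖∇u(x)‖`, let `e₁` be a unit vector orthogonal to `η(x)` and `ν`,
and let `p` be a symmetric bilinear form on `ℝ³`. Then
`⟨η(x), ∇‖∇u‖(x)⟩ + p(∇u(x), η(x)) = (−div η(x) + p(ν, η(x)) + ⟨Dη(x)(e₁), e₁⟩)‖∇u(x)‖`. -/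
theorem neumann_boundary_lemma_full {Ω : Set (EuclideanSpace ℝ (Fin 3))} (hΩ : IsOpen Ω)
    {f u : EuclideanSpace ℝ (Fin 3) → ℝ}
    (hf : ContDiffOn ℝ 2 f Ω) (hu : ContDiffOn ℝ 2 u Ω)
    {x : EuclideanSpace ℝ (Fin 3)} (hx : x ∈ Ω)
    (c : ℝ) (hc : c = f x)
    (S : Set (EuclideanSpace ℝ (Fin 3))) (hS : S = {y ∈ Ω | f y = c})
    (hreg : ∀ y ∈ S, gradient f y ≠ 0)
    (η : EuclideanSpace ℝ (Fin 3) → EuclideanSpace ℝ (Fin 3))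
    (hη : ∀ y, η y = ‖gradient f y‖⁻¹ • gradient f y)
    (hNeu : ∀ y ∈ S, ⟪gradient u y, η y⟫ = 0)
    (h0 : gradient u x ≠ 0)
    (ν : EuclideanSpace ℝ (Fin 3)) (hν : ν = ‖gradient u x‖⁻¹ • gradient u x)
    (e₁ : EuclideanSpace ℝ (Fin 3)) (he₁u : ‖e₁‖ = 1)
    (he₁η : ⟪e₁, η x⟫ = 0) (he₁ν : ⟪e₁, ν⟫ = 0)
    (p : EuclideanSpace ℝ (Fin 3) →ₗ[ℝ] EuclideanSpace ℝ (Fin 3) →ₗ[ℝ] ℝ)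
    (hpsymm : ∀ v w, p v w = p w v) :
    ⟪η x, gradient (fun y => ‖gradient u y‖) x⟫ + p (gradient u x) (η x) =
      (-(divg η x) + p ν (η x) + ⟪fderiv ℝ η x e₁, e₁⟫) * ‖gradient u x‖ := by
  subst hc hS
  have hfx := hf.contDiffAt (hΩ.mem_nhds hx)
  have hux := hu.contDiffAt (hΩ.mem_nhds hx)
  have hg := hfx.contDiffAt_gradient
  have hG := hux.contDiffAt_gradient
  have hGd : DifferentiableAt ℝ (gradient u) x := hG.differentiableAt (by simp)
  have hg0 : gradient f x ≠ 0 := hreg x ⟨hx, rfl⟩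
  have hηC : ContDiffAt ℝ 1 η x := by
    rw [funext hη]
    exact ((hg.norm ℝ hg0).inv (norm_ne_zero_iff.2 hg0)).smul hg
  have hηd : DifferentiableAt ℝ η x := hηC.differentiableAt (by simp)
  have hη1 : ∀ᶠ y in nhds x, ‖η y‖ = 1 := by
    filter_upwards [hg.continuousAt.eventually_ne hg0] with y hy
    rw [hη]
    exact norm_smul_inv_norm hy
  have hDη := inner_fderiv_self_eq_zero_of_norm_eq_one hηd hη1
  have hν1 : ‖ν‖ = 1 := hν ▸ norm_smul_inv_norm h0
  have hGν : gradient u x = ‖gradient u x‖ • ν := by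
    rw [hν, smul_inv_smul₀ (norm_ne_zero_iff.2 h0)]
  have hνη : ⟪ν, η x⟫ = 0 := by
    rw [hν, real_inner_smul_left, hNeu x ⟨hx, rfl⟩, mul_zero]
  have hdf : fderiv ℝ f x ≠ 0 := by
    rw [← toDual_gradient]
    exact (map_ne_zero_iff _ (InnerProductSpace.toDual ℝ _).injective).2 hg0
  have hfν : fderiv ℝ f x ν = 0 := by
    rw [hη, real_inner_smul_right] at hνη
    rw [← inner_gradient_eq_fderiv, real_inner_comm]
    exact (mul_eq_zero.1 hνη).resolve_left (inv_ne_zero (norm_ne_zero_iff.2 hg0))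
  have htan : ⟪gradient u x, fderiv ℝ η x ν⟫ + ⟪fderiv ℝ (gradient u) x ν, η x⟫ = 0 := by
    rw [← fderiv_inner_apply ℝ hGd hηd]
    refine fderiv_eq_zero_of_eq_const_on_levelSet (c := 0) (hfx.of_le (by norm_num))
      (hG.inner ℝ hηC) hdf ?_ hfν
    filter_upwards [hΩ.mem_nhds hx] with y hy hyf using hNeu y ⟨hy, hyf⟩
  have hnorm : ⟪η x, gradient (fun y => ‖gradient u y‖) x⟫ =
      ⟪fderiv ℝ (gradient u) x ν, η x⟫ := by
    have h := hGd.norm_mul_fderiv_norm h0 (η x)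
    rw [← inner_gradient_eq_fderiv, real_inner_comm (fderiv ℝ (gradient u) x (η x)),
      hGν, real_inner_smul_right, ← hGν, hux.inner_fderiv_gradient_comm] at h
    rw [real_inner_comm]
    exact mul_left_cancel₀ (norm_ne_zero_iff.2 h0) h
  have hon : Orthonormal ℝ ![ν, e₁, η x] := by
    refine ⟨fun i => ?_, fun i j hij => ?_⟩
    · fin_cases i <;> simp [hν1, he₁u, hη1.self_of_nhds]
    · have h1 : ⟪η x, ν⟫ = 0 := by rw [real_inner_comm, hνη]
      have h2 : ⟪η x, e₁⟫ = 0 := by rw [real_inner_comm, he₁η]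
      have h3 : ⟪ν, e₁⟫ = 0 := by rw [real_inner_comm, he₁ν]
      fin_cases i <;> fin_cases j <;>
        first | exact absurd rfl hij | simpa
  have hp : p (gradient u x) (η x) = ‖gradient u x‖ * p ν (η x) := by
    conv_lhs => rw [hGν]
    simp
  have htan' : ⟪gradient u x, fderiv ℝ η x ν⟫ = ‖gradient u x‖ * ⟪ν, fderiv ℝ η x ν⟫ := by
    conv_lhs => rw [hGν]
    rw [real_inner_smul_left]
  rw [hnorm, hp, divg_eq_of_orthonormal hηd hon, hDη, real_inner_comm e₁]
  linear_combination htan - htan'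
end
end
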